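/- Let r ≥ 1 be an integer, let ε ∈ (0,1), and let Y₀ ∈ ℝ^{n×p} satisfy ‖Y₀ᵀY₀ − I_p‖_F ≤ ε. Define the order-r Newton–Schulz sequence Y_{k+1} := Y_k · q_r(Y_kᵀY_k − I_p). Then for every k ≥ 0, ‖Y_kᵀY_k − I_p‖_F ≤ ‖Y₀ᵀY₀ − I_p‖_F^{(r+1)^k} ≤ ε^{(r+1)^k}. -/

import Mathlib

open Matrix BigOperators

noncomputable section

/-- Frobenius norm of a real matrix. -/
def frob {m k : ℕ} (A : Matrix (Fin m) (Fin k) ℝ) : ℝ :=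
  Real.sqrt (∑ i, ∑ j, (A i j) ^ 2)

/-- Degree-`r` Taylor polynomial `q_r(S) = ∑_{j=0}^r (-1)^j ((2j)!/(j!)²) S^j / 4^j`. -/
def qpoly {p : ℕ} (r : ℕ) (S : Matrix (Fin p) (Fin p) ℝ) : Matrix (Fin p) (Fin p) ℝ :=
  ∑ j ∈ Finset.range (r + 1),
    ((-1 : ℝ) ^ j * (Nat.factorial (2 * j) : ℝ) / (((Nat.factorial j : ℝ)) ^ 2 * 4 ^ j)) • S ^ j

section FrobeniusNorm

attribute [local instance] Matrix.frobeniusNormedRing Matrix.frobeniusNormedAlgebra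

open Polynomial

/-- The coefficients of the Taylor series of `(1 - t)^(-1/2)`. -/
def invSqrtCoeff (j : ℕ) : ℝ :=
  (Nat.factorial (2 * j) : ℝ) / ((Nat.factorial j : ℝ) ^ 2 * 4 ^ j)

/-- The Taylor polynomial of degree `r` of `(1 - t)^(-1/2)`. -/
def invSqrtTaylor (r : ℕ) : ℝ[X] :=
  ∑ j ∈ Finset.range (r + 1), C (invSqrtCoeff j) * X ^ j

/-- The coefficient of `t^(r + 1 + j)` in `1 - (1 - t) * (invSqrtTaylor r)^2`. -/
def residualCoeff (r j : ℕ) : ℝ :=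
  (2 * r + 1) * invSqrtCoeff r * invSqrtCoeff j / (r + 1 + j)

lemma invSqrtCoeff_nonneg (j : ℕ) : 0 ≤ invSqrtCoeff j := by
  unfold invSqrtCoeff; positivity

lemma residualCoeff_nonneg (r j : ℕ) : 0 ≤ residualCoeff r j := by
  have := invSqrtCoeff_nonneg r
  have := invSqrtCoeff_nonneg j
  unfold residualCoeff; positivity

lemma invSqrtCoeff_zero : invSqrtCoeff 0 = 1 := by simp [invSqrtCoeff]

lemma invSqrtCoeff_succ (r : ℕ) :
    2 * ((r : ℝ) + 1) * invSqrtCoeff (r + 1) = (2 * r + 1) * invSqrtCoeff r := by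
  have h : (Nat.factorial r : ℝ) ≠ 0 := by positivity
  rw [invSqrtCoeff, invSqrtCoeff, show 2 * (r + 1) = 2 * r + 1 + 1 by ring,
    Nat.factorial_succ, Nat.factorial_succ, Nat.factorial_succ]
  push_cast
  field_simp
  ring

lemma two_mul_one_sub_X_mul_derivative_invSqrtTaylor (r : ℕ) :
    2 * (1 - X) * derivative (invSqrtTaylor r) =
      invSqrtTaylor r - C ((2 * r + 1) * invSqrtCoeff r) * X ^ r := by
  induction r with
  | zero => simp [invSqrtTaylor, invSqrtCoeff_zero]
  | succ r ih =>
    have hs : invSqrtTaylor (r + 1) =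
        invSqrtTaylor r + C (invSqrtCoeff (r + 1)) * X ^ (r + 1) := Finset.sum_range_succ _ _
    have hc := congrArg (C : ℝ → ℝ[X]) (invSqrtCoeff_succ r)
    rw [hs, derivative_add, mul_add, ih, derivative_C_mul_X_pow, Nat.add_sub_cancel]
    simp only [map_mul, map_add, map_one, map_natCast, Nat.cast_add, Nat.cast_one, map_ofNat]
      at hc ⊢
    linear_combination (X ^ r : ℝ[X]) * hc

lemma one_sub_X_mul_invSqrtTaylor_sq (r : ℕ) :
    (1 - X) * invSqrtTaylor r ^ 2 =
      1 - ∑ j ∈ Finset.range (r + 1), C (residualCoeff r j) * X ^ (r + 1 + j) := by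
  have hd : derivative (∑ j ∈ Finset.range (r + 1), C (residualCoeff r j) * X ^ (r + 1 + j)) =
      C ((2 * r + 1) * invSqrtCoeff r) * X ^ r * invSqrtTaylor r := by
    rw [derivative_sum, invSqrtTaylor, Finset.mul_sum]
    refine Finset.sum_congr rfl fun j _ => ?_
    rw [derivative_C_mul_X_pow, show r + 1 + j - 1 = r + j by omega, pow_add,
      mul_mul_mul_comm, ← C_mul]
    congr 2
    have : (r : ℝ) + 1 + j ≠ 0 := by positivity
    rw [residualCoeff]
    push_cast
    field_simp
  have hz : derivative ((1 - X) * invSqrtTaylor r ^ 2 -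
      (1 - ∑ j ∈ Finset.range (r + 1), C (residualCoeff r j) * X ^ (r + 1 + j))) = 0 := by
    rw [derivative_sub, derivative_sub, hd, derivative_mul, derivative_pow]
    simp only [derivative_sub, derivative_one, derivative_X, Nat.cast_ofNat, map_ofNat]
    linear_combination invSqrtTaylor r * two_mul_one_sub_X_mul_derivative_invSqrtTaylor r
  have hconst := eq_C_of_derivative_eq_zero hz
  have hq0 : (invSqrtTaylor r).coeff 0 = 1 := by
    simp [invSqrtTaylor, Finset.sum_range_succ', invSqrtCoeff_zero]
  rw [← sub_eq_zero, hconst, C_eq_zero, coeff_zero_eq_eval_zero]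
  rw [coeff_zero_eq_eval_zero] at hq0
  simp [hq0, eval_finsetSum]

lemma sum_residualCoeff (r : ℕ) : ∑ j ∈ Finset.range (r + 1), residualCoeff r j = 1 := by
  have h := congrArg (eval 1) (one_sub_X_mul_invSqrtTaylor_sq r)
  simp [eval_finsetSum] at h
  linarith

lemma norm_sum_residualCoeff_le {A : Type*} [NormedRing A] [NormedAlgebra ℝ A] (r : ℕ) (a : A)
    (ha : ‖a‖ ≤ 1) :
    ‖∑ j ∈ Finset.range (r + 1), residualCoeff r j • a ^ (r + 1 + j)‖ ≤ ‖a‖ ^ (r + 1) := by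
  calc _ ≤ ∑ j ∈ Finset.range (r + 1), residualCoeff r j * ‖a‖ ^ (r + 1) := by
        refine norm_sum_le_of_le _ fun j _ => ?_
        rw [norm_smul, Real.norm_of_nonneg (residualCoeff_nonneg r j)]
        refine mul_le_mul_of_nonneg_left ?_ (residualCoeff_nonneg r j)
        exact (norm_pow_le' a (by omega)).trans
          (pow_le_pow_of_le_one (norm_nonneg a) ha (by omega))
    _ = ‖a‖ ^ (r + 1) := by rw [← Finset.sum_mul, sum_residualCoeff, one_mul]

lemma qpoly_eq_aeval {p : ℕ} (r : ℕ) (S : Matrix (Fin p) (Fin p) ℝ) :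
    qpoly r S = aeval (-S) (invSqrtTaylor r) := by
  rw [qpoly, invSqrtTaylor, map_sum]
  refine Finset.sum_congr rfl fun j _ => ?_
  rw [map_mul, aeval_C, map_pow, aeval_X, ← Algebra.smul_def, ← neg_one_smul ℝ S, _root_.smul_pow,
    smul_smul, invSqrtCoeff, mul_div_assoc, mul_comm]

lemma qpoly_transpose {p : ℕ} (r : ℕ) (S : Matrix (Fin p) (Fin p) ℝ) :
    (qpoly r S)ᵀ = qpoly r Sᵀ := by
  simp [qpoly, transpose_sum, transpose_pow]

lemma frob_eq_norm {p : ℕ} (S : Matrix (Fin p) (Fin p) ℝ) : frob S = ‖S‖ := by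
  simp [frob, frobenius_norm_def, Real.sqrt_eq_rpow]

lemma frob_newtonSchulz_step_le {n p : ℕ} (r : ℕ) (Y : Matrix (Fin n) (Fin p) ℝ)
    (h : frob (Yᵀ * Y - 1) ≤ 1) :
    frob ((Y * qpoly r (Yᵀ * Y - 1))ᵀ * (Y * qpoly r (Yᵀ * Y - 1)) - 1) ≤
      frob (Yᵀ * Y - 1) ^ (r + 1) := by
  set S := Yᵀ * Y - 1 with hS
  have hST : Sᵀ = S := by simp [hS, transpose_mul]
  have hY : Yᵀ * Y = aeval (-S) (1 - X : ℝ[X]) := by simp [hS]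
  have key : (Y * qpoly r S)ᵀ * (Y * qpoly r S) - 1 =
      -∑ j ∈ Finset.range (r + 1), residualCoeff r j • (-S) ^ (r + 1 + j) := by
    have hprod : (Y * qpoly r S)ᵀ * (Y * qpoly r S) =
        aeval (-S) ((1 - X) * invSqrtTaylor r ^ 2) := by
      calc _ = qpoly r S * (Yᵀ * Y) * qpoly r S := by
            rw [transpose_mul, qpoly_transpose, hST]; simp only [Matrix.mul_assoc]
        _ = aeval (-S) (invSqrtTaylor r * (1 - X) * invSqrtTaylor r) := by
            rw [hY, qpoly_eq_aeval, map_mul, map_mul]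
        _ = _ := by congr 1; ring
    rw [hprod, one_sub_X_mul_invSqrtTaylor_sq, map_sub, map_one, map_sum, sub_sub_cancel_left]
    simp [Algebra.smul_def]
  rw [frob_eq_norm] at h
  rw [key, frob_eq_norm, frob_eq_norm, norm_neg, ← norm_neg S]
  exact norm_sum_residualCoeff_le r (-S) (by rwa [norm_neg])

end FrobeniusNorm

/-- Order-`(r+1)` decay of the infeasibility along the order-`r` Newton–Schulz iteration,
starting in the safe region `St(p,n)^ε`. -/
theorem newton_schulz_order_r_decay {n p : ℕ} (r : ℕ) (hr : 1 ≤ r)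
    (ε : ℝ) (hε : ε ∈ Set.Ioo (0 : ℝ) 1)
    (Y : ℕ → Matrix (Fin n) (Fin p) ℝ)
    (h0 : frob ((Y 0)ᵀ * Y 0 - 1) ≤ ε)
    (hrec : ∀ k, Y (k + 1) = Y k * qpoly r ((Y k)ᵀ * Y k - 1)) :
    ∀ k, frob ((Y k)ᵀ * Y k - 1) ≤ (frob ((Y 0)ᵀ * Y 0 - 1)) ^ ((r + 1) ^ k)
      ∧ (frob ((Y 0)ᵀ * Y 0 - 1)) ^ ((r + 1) ^ k) ≤ ε ^ ((r + 1) ^ k) := by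
  have hnonneg : ∀ k, 0 ≤ frob ((Y k)ᵀ * Y k - 1) := fun k => Real.sqrt_nonneg _
  intro k
  refine ⟨?_, pow_le_pow_left₀ (hnonneg 0) h0 _⟩
  induction k with
  | zero => simp
  | succ k ih =>
    have hk : frob ((Y k)ᵀ * Y k - 1) ≤ 1 :=
      ih.trans (pow_le_one₀ (hnonneg 0) (h0.trans hε.2.le))
    rw [hrec k, pow_succ, pow_mul]
    exact (frob_newtonSchulz_step_le r (Y k) hk).trans (pow_le_pow_left₀ (hnonneg k) ih _)
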